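/- Let n ≥ 3 be odd and let w > 1. Then λ₁(w), the largest eigenvalue of A(w), equals the largest eigenvalue of C₁(w), and λ₂(w), the second-largest eigenvalue of A(w), equals the largest eigenvalue of C₂(w). -/

import Mathlib

open Polynomial Real Filter

noncomputable def pathA (n : ℕ) (w : ℝ) : Matrix (Fin n) (Fin n) ℝ :=
  Matrix.of fun i j =>
    if i = j ∧ (i.val = 0 ∨ i.val = n - 1) then w
    else if i.val + 1 = j.val ∨ j.val + 1 = i.val then 1
    else 0

/-- `μ` lists the eigenvalues of `pathA n w` with multiplicity, in decreasing order. -/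
def IsEigList (n : ℕ) (w : ℝ) (μ : Fin n → ℝ) : Prop :=
  Antitone μ ∧ (pathA n w).charpoly = ∏ i, (Polynomial.X - Polynomial.C (μ i))

/-- The `m × m` symmetric tridiagonal matrix with diagonal `(w, 0, …, 0)`, all
sub/superdiagonal entries `1` except the last ones, which are `√2`. -/
noncomputable def C1mat (m : ℕ) (w : ℝ) : Matrix (Fin m) (Fin m) ℝ :=
  Matrix.of fun i j =>
    if i = j then (if i.val = 0 then w else 0)
    else if i.val + 1 = j.val ∨ j.val + 1 = i.val then
      (if max i.val j.val = m - 1 then Real.sqrt 2 else 1)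
    else 0

/-- The `m × m` symmetric tridiagonal matrix with diagonal `(w, 0, …, 0)` and all
sub/superdiagonal entries `1`. -/
noncomputable def C2mat (m : ℕ) (w : ℝ) : Matrix (Fin m) (Fin m) ℝ :=
  Matrix.of fun i j =>
    if i = j then (if i.val = 0 then w else 0)
    else if i.val + 1 = j.val ∨ j.val + 1 = i.val then 1
    else 0

lemma exists_perm_of_map_univ_eq {ι β : Type*} [Fintype ι] {f g : ι → β}
    (h : Multiset.map f Finset.univ.val = Multiset.map g Finset.univ.val) :
    ∃ σ : Equiv.Perm ι, f = g ∘ σ := by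
  classical
  have hcard : ∀ c, Fintype.card {a // f a = c} = Fintype.card {a // g a = c} := fun c => by
    have hc := congrArg (Multiset.count c) h
    rw [Multiset.count_map, Multiset.count_map] at hc
    simp only [Fintype.card_subtype, Finset.card_def, Finset.filter_val, eq_comm (b := c)]
    exact hc
  exact ⟨Equiv.ofFiberEquiv fun c => Fintype.equivOfCardEq (hcard c),
    funext fun a => (Equiv.ofFiberEquiv_map _ a).symm⟩

/-- An orthogonal change of coordinates diagonalizing a real symmetric matrix whose
characteristic polynomial has the roots `μ i`. -/
lemma Matrix.IsHermitian.exists_linearEquiv_diagonalizing {ι : Type*} [Fintype ι] [DecidableEq ι]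
    {M : Matrix ι ι ℝ} (hM : M.IsHermitian) {μ : ι → ℝ}
    (hμ : M.charpoly = ∏ i, (Polynomial.X - Polynomial.C (μ i))) :
    ∃ c : (ι → ℝ) ≃ₗ[ℝ] (ι → ℝ), (∀ v, v ⬝ᵥ v = ∑ i, c v i ^ 2) ∧
      ∀ v, v ⬝ᵥ M.mulVec v = ∑ i, μ i * c v i ^ 2 := by
  have hroots : Multiset.map μ Finset.univ.val = Multiset.map hM.eigenvalues Finset.univ.val := by
    have h := hM.roots_charpoly_eq_eigenvalues
    rw [hμ, Polynomial.roots_prod _ _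
      (Finset.prod_ne_zero_iff.2 fun i _ => Polynomial.X_sub_C_ne_zero _)] at h
    simpa using h
  obtain ⟨σ, hσ⟩ := exists_perm_of_map_univ_eq hroots
  set b := hM.eigenvectorBasis.reindex σ.symm with hb
  have hMb : ∀ i, M.mulVec (b i) = μ i • (b i : ι → ℝ) := fun i => by
    simpa [hb, hσ] using hM.mulVec_eigenvectorBasis (σ i)
  have hdot : ∀ v u : ι → ℝ, v ⬝ᵥ u = inner ℝ (WithLp.toLp 2 v) (WithLp.toLp 2 u) := fun v u => by
    simp [EuclideanSpace.inner_toLp_toLp, dotProduct_comm]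
  have hinner : ∀ v u : ι → ℝ,
      v ⬝ᵥ u = ∑ i, b.repr (WithLp.toLp 2 v) i * b.repr (WithLp.toLp 2 u) i := fun v u => by
    rw [hdot, ← b.sum_inner_mul_inner]
    refine Finset.sum_congr rfl fun i _ => ?_
    rw [b.repr_apply_apply, b.repr_apply_apply, real_inner_comm]
  refine ⟨(WithLp.linearEquiv 2 ℝ (ι → ℝ)).symm.trans
    (b.repr.toLinearEquiv.trans (WithLp.linearEquiv 2 ℝ (ι → ℝ))), fun v => ?_, fun v => ?_⟩
  · rw [hinner]
    exact Finset.sum_congr rfl fun i _ => (sq _).symm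
  · rw [hinner]
    refine Finset.sum_congr rfl fun i _ => ?_
    have h : b.repr (WithLp.toLp 2 (M.mulVec v)) i = μ i * b.repr (WithLp.toLp 2 v) i := by
      rw [b.repr_apply_apply, b.repr_apply_apply]
      have h1 := hdot (b i) (M.mulVec v)
      have h2 := hdot (b i) v
      rw [WithLp.toLp_ofLp] at h1 h2
      rw [← h1, ← h2, Matrix.dotProduct_mulVec, ← Matrix.mulVec_transpose,
        ← Matrix.conjTranspose_eq_transpose_of_trivial, hM.eq, hMb, smul_dotProduct, smul_eq_mul]
    rw [h]
    change _ = μ i * b.repr (WithLp.toLp 2 v) i ^ 2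
    ring

/-- The largest eigenvalue of a real symmetric matrix is the maximum of its Rayleigh quotient. -/
lemma Matrix.IsHermitian.exists_isGreatest_spectrum {ι : Type*} [Fintype ι] [DecidableEq ι]
    [Nonempty ι] {M : Matrix ι ι ℝ} (hM : M.IsHermitian) :
    ∃ t, IsGreatest (spectrum ℝ M) t ∧ (∃ x, x ≠ 0 ∧ x ⬝ᵥ M.mulVec x = t * (x ⬝ᵥ x)) ∧
      ∀ x, x ⬝ᵥ M.mulVec x ≤ t * (x ⬝ᵥ x) := by
  obtain ⟨c, hc1, hc2⟩ := hM.exists_linearEquiv_diagonalizing hM.charpoly_eq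
  obtain ⟨i, hi⟩ := Finite.exists_max hM.eigenvalues
  refine ⟨hM.eigenvalues i, ⟨?_, ?_⟩, ⟨c.symm (Pi.single i 1), ?_, ?_⟩, fun x => ?_⟩
  · exact hM.eigenvalues_mem_spectrum_real i
  · rw [hM.spectrum_real_eq_range_eigenvalues]
    rintro _ ⟨j, rfl⟩
    exact hi j
  · simp
  · rw [hc1, hc2]
    simp [Pi.single_apply]
  · rw [hc1, hc2, Finset.mul_sum]
    exact Finset.sum_le_sum fun j _ => mul_le_mul_of_nonneg_right (hi j) (sq_nonneg _)

section Fin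

variable {m : ℕ} {M : Matrix (Fin (m + 2)) (Fin (m + 2)) ℝ} {μ : Fin (m + 2) → ℝ}

/-- Cauchy interlacing, upper half: every hyperplane contains a vector whose Rayleigh quotient
is at least the second-largest eigenvalue. -/
lemma Matrix.IsHermitian.exists_second_eigenvalue_le (hM : M.IsHermitian) (hanti : Antitone μ)
    (hμ : M.charpoly = ∏ i, (Polynomial.X - Polynomial.C (μ i)))
    (φ : (Fin (m + 2) → ℝ) →ₗ[ℝ] ℝ) :
    ∃ v, v ≠ 0 ∧ φ v = 0 ∧ μ 1 * (v ⬝ᵥ v) ≤ v ⬝ᵥ M.mulVec v := by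
  obtain ⟨c, hc1, hc2⟩ := hM.exists_linearEquiv_diagonalizing hμ
  have key : ∀ s t : ℝ, ¬(s = 0 ∧ t = 0) →
      φ (c.symm (s • Pi.single 0 1 + t • Pi.single 1 1)) = 0 →
      ∃ v, v ≠ 0 ∧ φ v = 0 ∧ μ 1 * (v ⬝ᵥ v) ≤ v ⬝ᵥ M.mulVec v := by
    intro s t hst hφ
    refine ⟨_, ?_, hφ, ?_⟩
    · rw [Ne, LinearEquiv.map_eq_zero_iff]
      intro h
      exact hst ⟨by simpa using congrFun h 0, by simpa using congrFun h 1⟩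
    · rw [hc1, hc2, Finset.mul_sum]
      refine Finset.sum_le_sum fun i _ => ?_
      rw [LinearEquiv.apply_symm_apply]
      rcases Decidable.em (i ≤ 1) with hi | hi
      · exact mul_le_mul_of_nonneg_right (hanti hi) (sq_nonneg _)
      · have h0 : i ≠ 0 := by rintro rfl; exact hi (Fin.zero_le _)
        have h1 : i ≠ 1 := by rintro rfl; exact hi le_rfl
        simp [h0, h1]
  by_cases h : φ (c.symm (Pi.single 0 1)) = 0
  · exact key 1 0 (by simp) (by simpa using h)
  · refine key (-φ (c.symm (Pi.single 1 1))) (φ (c.symm (Pi.single 0 1))) (fun h' => h h'.2) ?_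
    simp only [map_add, map_smul, smul_eq_mul]
    ring

/-- Cauchy interlacing, lower half: every plane contains a vector whose Rayleigh quotient
is at most the second-largest eigenvalue. -/
lemma Matrix.IsHermitian.exists_le_second_eigenvalue (hM : M.IsHermitian) (hanti : Antitone μ)
    (hμ : M.charpoly = ∏ i, (Polynomial.X - Polynomial.C (μ i))) (a b : Fin (m + 2) → ℝ) :
    ∃ s t : ℝ, ¬(s = 0 ∧ t = 0) ∧ (s • a + t • b) ⬝ᵥ M.mulVec (s • a + t • b) ≤
      μ 1 * ((s • a + t • b) ⬝ᵥ (s • a + t • b)) := by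
  obtain ⟨c, hc1, hc2⟩ := hM.exists_linearEquiv_diagonalizing hμ
  have key : ∀ s t : ℝ, c (s • a + t • b) 0 = 0 →
      (s • a + t • b) ⬝ᵥ M.mulVec (s • a + t • b) ≤
      μ 1 * ((s • a + t • b) ⬝ᵥ (s • a + t • b)) := by
    intro s t h0
    rw [hc1, hc2, Finset.mul_sum]
    refine Finset.sum_le_sum fun i _ => ?_
    rcases Decidable.em (i = 0) with rfl | hi
    · simp [h0]
    · refine mul_le_mul_of_nonneg_right (hanti ?_) (sq_nonneg _)
      exact Fin.one_le_of_ne_zero hi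
  by_cases h : c a 0 = 0
  · exact ⟨1, 0, by simp, key _ _ (by simp [h])⟩
  · refine ⟨-c b 0, c a 0, fun h' => h h'.2, key _ _ ?_⟩
    simp only [map_add, map_smul, Pi.add_apply, Pi.smul_apply, smul_eq_mul]
    ring

lemma Matrix.IsHermitian.rayleigh_max (hM : M.IsHermitian) (hanti : Antitone μ)
    (hμ : M.charpoly = ∏ i, (Polynomial.X - Polynomial.C (μ i))) :
    (∃ v, v ≠ 0 ∧ v ⬝ᵥ M.mulVec v = μ 0 * (v ⬝ᵥ v)) ∧
      ∀ v, v ⬝ᵥ M.mulVec v ≤ μ 0 * (v ⬝ᵥ v) := by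
  obtain ⟨c, hc1, hc2⟩ := hM.exists_linearEquiv_diagonalizing hμ
  refine ⟨⟨c.symm (Pi.single 0 1), by simp, ?_⟩, fun v => ?_⟩
  · rw [hc1, hc2]
    simp [Pi.single_apply]
  · rw [hc1, hc2, Finset.mul_sum]
    exact Finset.sum_le_sum fun j _ =>
      mul_le_mul_of_nonneg_right (hanti (Fin.zero_le j)) (sq_nonneg _)

end Fin

/-- The quadratic form of a symmetric tridiagonal matrix. -/
lemma tridiagonal_form {p : ℕ} (M : Matrix (Fin (p + 1)) (Fin (p + 1)) ℝ) (d e f : ℕ → ℝ)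
    (hM : ∀ i j, M i j = (if i.val = j.val then d i else 0) +
      (if i.val + 1 = j.val then e i else 0) + (if j.val + 1 = i.val then e j else 0)) :
    (fun i : Fin (p + 1) => f i) ⬝ᵥ M.mulVec (fun i => f i) =
      ∑ i ∈ Finset.range (p + 1), d i * f i ^ 2 +
        2 * ∑ i ∈ Finset.range p, e i * (f i * f (i + 1)) := by
  have hoff : ∑ i ∈ Finset.range (p + 1), ∑ j ∈ Finset.range (p + 1),
      (if i + 1 = j then e i * (f i * f j) else 0) =
      ∑ i ∈ Finset.range p, e i * (f i * f (i + 1)) := by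
    rw [Finset.sum_range_succ]
    simp only [Finset.sum_ite_eq, Finset.mem_range]
    rw [if_neg (lt_irrefl _), add_zero]
    refine Finset.sum_congr rfl fun i hi => ?_
    rw [if_pos (by simpa using hi)]
  have hoff' : ∑ i ∈ Finset.range (p + 1), ∑ j ∈ Finset.range (p + 1),
      (if j + 1 = i then e j * (f j * f i) else 0) =
      ∑ i ∈ Finset.range p, e i * (f i * f (i + 1)) := by
    rw [Finset.sum_comm, hoff]
  have hdiag : ∑ i ∈ Finset.range (p + 1), ∑ j ∈ Finset.range (p + 1),
      (if i = j then d i * (f i * f j) else 0) = ∑ i ∈ Finset.range (p + 1), d i * f i ^ 2 := by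
    refine Finset.sum_congr rfl fun i hi => ?_
    rw [Finset.sum_ite_eq, if_pos hi, sq]
  rw [two_mul, ← add_assoc]
  nth_rw 2 [← hoff']
  rw [← hoff, ← hdiag, ← Finset.sum_add_distrib, ← Finset.sum_add_distrib, ← Fin.sum_univ_eq_sum_range
    (fun i => (∑ j ∈ Finset.range (p + 1), (if i = j then d i * (f i * f j) else 0) +
      ∑ j ∈ Finset.range (p + 1), (if i + 1 = j then e i * (f i * f j) else 0)) +
      ∑ j ∈ Finset.range (p + 1), (if j + 1 = i then e j * (f j * f i) else 0))]
  refine Finset.sum_congr rfl fun i _ => ?_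
  rw [← Finset.sum_add_distrib, ← Finset.sum_add_distrib, ← Fin.sum_univ_eq_sum_range
    (fun j => (if (i : ℕ) = j then d i * (f i * f j) else 0) +
      (if (i : ℕ) + 1 = j then e i * (f i * f j) else 0) +
      (if j + 1 = (i : ℕ) then e j * (f j * f i) else 0)), Matrix.mulVec, dotProduct,
    Finset.mul_sum]
  refine Finset.sum_congr rfl fun j _ => ?_
  rw [hM]
  split_ifs <;> ring

lemma dotProduct_self_eq_sum_range (m : ℕ) (f : ℕ → ℝ) :
    (fun i : Fin m => f i) ⬝ᵥ (fun i : Fin m => f i) = ∑ i ∈ Finset.range m, f i ^ 2 := by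
  rw [← Fin.sum_univ_eq_sum_range (fun i => f i ^ 2)]
  exact Finset.sum_congr rfl fun i _ => (sq _).symm

lemma exists_nat_extension {m : ℕ} (x : Fin m → ℝ) : ∃ f : ℕ → ℝ, x = fun i : Fin m => f i :=
  ⟨fun i => if h : i < m then x ⟨i, h⟩ else 0, by funext i; simp⟩

lemma C2mat_form (p : ℕ) (w : ℝ) (f : ℕ → ℝ) :
    (fun i : Fin (p + 1) => f i) ⬝ᵥ (C2mat (p + 1) w).mulVec (fun i => f i) =
      w * f 0 ^ 2 + 2 * ∑ i ∈ Finset.range p, f i * f (i + 1) := by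
  rw [tridiagonal_form _ (fun i => if i = 0 then w else 0) (fun _ => 1)]
  · rw [Finset.sum_range_succ']
    simp
  · intro i j
    simp only [C2mat, Matrix.of_apply, Fin.ext_iff]
    split_ifs <;> first | omega | simp

lemma C1mat_form (p : ℕ) (w : ℝ) (f : ℕ → ℝ) :
    (fun i : Fin (p + 2) => f i) ⬝ᵥ (C1mat (p + 2) w).mulVec (fun i => f i) =
      w * f 0 ^ 2 + 2 * ∑ i ∈ Finset.range p, f i * f (i + 1) + 2 * √2 * (f p * f (p + 1)) := by
  rw [tridiagonal_form _ (fun i => if i = 0 then w else 0) (fun i => if i = p then √2 else 1)]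
  · have : ∑ i ∈ Finset.range p, (if i = p then √2 else 1) * (f i * f (i + 1)) =
        ∑ i ∈ Finset.range p, f i * f (i + 1) :=
      Finset.sum_congr rfl fun i hi => by
        rw [if_neg (Finset.mem_range.1 hi).ne, one_mul]
    rw [Finset.sum_range_succ', Finset.sum_range_succ (fun i => (if i = p then √2 else 1) * _), this]
    simp
    ring
  · intro i j
    simp only [C1mat, Matrix.of_apply, Fin.ext_iff]
    split_ifs <;> first | omega | simp

/-- The quadratic form of the path splits along its middle vertex. -/
lemma pathA_form (p : ℕ) (w : ℝ) (f : ℕ → ℝ) :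
    (fun i : Fin (2 * p + 3) => f i) ⬝ᵥ (pathA (2 * p + 3) w).mulVec (fun i => f i) =
      (w * f 0 ^ 2 + 2 * ∑ i ∈ Finset.range p, f i * f (i + 1)) +
      (w * f (2 * p + 2) ^ 2 +
        2 * ∑ i ∈ Finset.range p, f (2 * p + 2 - i) * f (2 * p + 2 - (i + 1))) +
      2 * f (p + 1) * (f p + f (p + 2)) := by
  have hsum : ∑ i ∈ Finset.range (2 * p + 2), f i * f (i + 1) =
      ∑ i ∈ Finset.range (p + 1), f i * f (i + 1) +
      ∑ i ∈ Finset.range (p + 1), f (2 * p + 2 - i) * f (2 * p + 2 - (i + 1)) := by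
    rw [show 2 * p + 2 = (p + 1) + (p + 1) by ring, Finset.sum_range_add]
    congr 1
    rw [← Finset.sum_range_reflect]
    refine Finset.sum_congr rfl fun i hi => ?_
    have hi := Finset.mem_range.1 hi
    rw [show p + 1 + (p + 1 - 1 - i) = p + 1 + (p + 1) - (i + 1) by omega,
      show p + 1 + (p + 1) - (i + 1) + 1 = p + 1 + (p + 1) - i by omega, mul_comm]
  rw [tridiagonal_form (p := 2 * p + 2) _ (fun i => if i = 0 ∨ i = 2 * p + 2 then w else 0)
    (fun _ => 1)]
  · have hd : ∑ i ∈ Finset.range (2 * p + 2 + 1), (if i = 0 ∨ i = 2 * p + 2 then w else 0) * f i ^ 2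
        = w * f 0 ^ 2 + w * f (2 * p + 2) ^ 2 := by
      rw [Finset.sum_range_succ, Finset.sum_range_succ', Finset.sum_eq_zero]
      · simp
      · intro i hi
        have hi := Finset.mem_range.1 hi
        rw [if_neg (by omega), zero_mul]
    simp only [one_mul]
    rw [hd, hsum, Finset.sum_range_succ, Finset.sum_range_succ _ p,
      show 2 * p + 2 - p = p + 2 by omega, show 2 * p + 2 - (p + 1) = p + 1 by omega]
    ring
  · intro i j
    simp only [pathA, Matrix.of_apply, Fin.ext_iff]
    split_ifs <;> first | omega | simp

lemma pathA_sum_sq (p : ℕ) (f : ℕ → ℝ) :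
    ∑ i ∈ Finset.range (2 * p + 3), f i ^ 2 = ∑ i ∈ Finset.range (p + 1), f i ^ 2 +
      ∑ i ∈ Finset.range (p + 1), f (2 * p + 2 - i) ^ 2 + f (p + 1) ^ 2 := by
  rw [show 2 * p + 3 = (p + 1 + 1) + (p + 1) by ring, Finset.sum_range_add,
    Finset.sum_range_succ _ (p + 1), ← Finset.sum_range_reflect _ (p + 1)]
  have : ∑ i ∈ Finset.range (p + 1), f (p + 1 + 1 + i) ^ 2 =
      ∑ i ∈ Finset.range (p + 1), f (2 * p + 2 - (p + 1 - 1 - i)) ^ 2 :=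
    Finset.sum_congr rfl fun i hi => by
      have hi := Finset.mem_range.1 hi
      rw [show 2 * p + 2 - (p + 1 - 1 - i) = p + 1 + 1 + i by omega]
  rw [this, Finset.sum_range_reflect (fun i => f (2 * p + 2 - i) ^ 2),
    Finset.sum_range_reflect (fun i => f i ^ 2)]
  ring

lemma isHermitian_pathA (n : ℕ) (w : ℝ) : (pathA n w).IsHermitian := by
  ext i j
  simp only [pathA, Matrix.conjTranspose_apply, Matrix.of_apply, star_trivial, Fin.ext_iff]
  split_ifs <;> first | rfl | omega

lemma isHermitian_C1mat (m : ℕ) (w : ℝ) : (C1mat m w).IsHermitian := by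
  ext i j
  simp only [C1mat, Matrix.conjTranspose_apply, Matrix.of_apply, star_trivial, Fin.ext_iff,
    max_comm j.val i.val]
  split_ifs <;> first | rfl | omega

lemma isHermitian_C2mat (m : ℕ) (w : ℝ) : (C2mat m w).IsHermitian := by
  ext i j
  simp only [C2mat, Matrix.conjTranspose_apply, Matrix.of_apply, star_trivial, Fin.ext_iff]
  split_ifs <;> first | rfl | omega

lemma dotProduct_self_pos_of_ne_zero {ι : Type*} [Fintype ι] {v : ι → ℝ} (hv : v ≠ 0) :
    0 < v ⬝ᵥ v :=
  lt_of_le_of_ne (Finset.sum_nonneg fun i _ => mul_self_nonneg (v i))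
    fun h => hv (dotProduct_self_eq_zero.1 h.symm)

lemma mul_add_mul_le_sqrt_mul_sqrt (a b c d : ℝ) :
    a * b + c * d ≤ √(a ^ 2 + c ^ 2) * √(b ^ 2 + d ^ 2) := by
  rw [← Real.sqrt_mul (by positivity)]
  exact Real.le_sqrt_of_sq_le (by nlinarith [sq_nonneg (a * d - b * c)])

/-- Folding a vector on the path onto the quotient chain preserves the norm and does not
decrease the quadratic form. -/
lemma exists_fold (p : ℕ) (w : ℝ) (f : ℕ → ℝ) : ∃ y : ℕ → ℝ,
    ∑ i ∈ Finset.range (p + 2), y i ^ 2 = ∑ i ∈ Finset.range (2 * p + 3), f i ^ 2 ∧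
    (fun i : Fin (2 * p + 3) => f i) ⬝ᵥ (pathA (2 * p + 3) w).mulVec (fun i => f i) ≤
    (fun i : Fin (p + 2) => y i) ⬝ᵥ (C1mat (p + 2) w).mulVec (fun i => y i) := by
  set z : ℕ → ℝ := fun i => √(f i ^ 2 + f (2 * p + 2 - i) ^ 2) with hz
  have hz2 : ∀ i, z i ^ 2 = f i ^ 2 + f (2 * p + 2 - i) ^ 2 := fun i =>
    Real.sq_sqrt (by positivity)
  set y : ℕ → ℝ := fun i => if i < p + 1 then z i else |f (p + 1)| with hy
  have hyz : ∀ i, i < p + 1 → y i = z i := fun i hi => if_pos hi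
  have hyl : y (p + 1) = |f (p + 1)| := if_neg (lt_irrefl _)
  refine ⟨y, ?_, ?_⟩
  · rw [pathA_sum_sq, Finset.sum_range_succ, hyl, sq_abs, ← Finset.sum_add_distrib]
    congr 1
    exact Finset.sum_congr rfl fun i hi => by rw [hyz i (Finset.mem_range.1 hi), hz2]
  · rw [pathA_form, C1mat_form, hyl, hyz p (by omega), hyz 0 (by omega), hz2]
    have hE : ∑ i ∈ Finset.range p, f i * f (i + 1) +
        ∑ i ∈ Finset.range p, f (2 * p + 2 - i) * f (2 * p + 2 - (i + 1)) ≤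
        ∑ i ∈ Finset.range p, y i * y (i + 1) := by
      rw [← Finset.sum_add_distrib]
      refine Finset.sum_le_sum fun i hi => ?_
      have hi := Finset.mem_range.1 hi
      rw [hyz i (by omega), hyz (i + 1) (by omega)]
      exact mul_add_mul_le_sqrt_mul_sqrt _ _ _ _
    have hL : f (p + 1) * (f p + f (p + 2)) ≤ √2 * (z p * |f (p + 1)|) := by
      have h := mul_add_mul_le_sqrt_mul_sqrt (f (p + 1)) (f p) (f (p + 1)) (f (p + 2))
      rw [← two_mul, Real.sqrt_mul (by norm_num), Real.sqrt_sq_eq_abs] at h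
      have : z p = √(f p ^ 2 + f (p + 2) ^ 2) := by
        rw [hz]; simp only [show 2 * p + 2 - p = p + 2 by omega]
      rw [this]
      linarith
    rw [Nat.sub_zero]
    linarith

/-- The vector on the path with `s • x` on the left half, `r` in the middle and the mirror image
of `t • x` on the right half. -/
noncomputable def twoSidedLift (p : ℕ) (x : ℕ → ℝ) (s t r : ℝ) (i : ℕ) : ℝ :=
  if i < p + 1 then s * x i else if i = p + 1 then r else t * x (2 * p + 2 - i)

lemma twoSidedLift_sum_sq (p : ℕ) (x : ℕ → ℝ) (s t r : ℝ) :
    ∑ i ∈ Finset.range (2 * p + 3), twoSidedLift p x s t r i ^ 2 =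
      (s ^ 2 + t ^ 2) * ∑ i ∈ Finset.range (p + 1), x i ^ 2 + r ^ 2 := by
  rw [pathA_sum_sq, add_mul, Finset.mul_sum, Finset.mul_sum]
  congr 1
  · congr 1 <;> refine Finset.sum_congr rfl fun i hi => ?_
    · rw [twoSidedLift, if_pos (Finset.mem_range.1 hi), mul_pow]
    · have hi := Finset.mem_range.1 hi
      rw [twoSidedLift, if_neg (by omega), if_neg (by omega),
        show 2 * p + 2 - (2 * p + 2 - i) = i by omega, mul_pow]
  · simp [twoSidedLift]

lemma twoSidedLift_form (p : ℕ) (w : ℝ) (x : ℕ → ℝ) (s t r : ℝ) :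
    (fun i : Fin (2 * p + 3) => twoSidedLift p x s t r i) ⬝ᵥ
      (pathA (2 * p + 3) w).mulVec (fun i => twoSidedLift p x s t r i) =
    (s ^ 2 + t ^ 2) * (w * x 0 ^ 2 + 2 * ∑ i ∈ Finset.range p, x i * x (i + 1)) +
      2 * r * ((s + t) * x p) := by
  have hl : ∀ i, i < p + 1 → twoSidedLift p x s t r i = s * x i := fun i hi => if_pos hi
  have hr : ∀ i, i < p + 1 → twoSidedLift p x s t r (2 * p + 2 - i) = t * x i := fun i hi => by
    rw [twoSidedLift, if_neg (by omega), if_neg (by omega),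
      show 2 * p + 2 - (2 * p + 2 - i) = i by omega]
  have hm : twoSidedLift p x s t r (p + 1) = r := by simp [twoSidedLift]
  have h1 : ∑ i ∈ Finset.range p, twoSidedLift p x s t r i * twoSidedLift p x s t r (i + 1) =
      s ^ 2 * ∑ i ∈ Finset.range p, x i * x (i + 1) := by
    rw [Finset.mul_sum]
    refine Finset.sum_congr rfl fun i hi => ?_
    have hi := Finset.mem_range.1 hi
    rw [hl i (by omega), hl (i + 1) (by omega)]
    ring
  have h2 : ∑ i ∈ Finset.range p, twoSidedLift p x s t r (2 * p + 2 - i) *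
      twoSidedLift p x s t r (2 * p + 2 - (i + 1)) =
      t ^ 2 * ∑ i ∈ Finset.range p, x i * x (i + 1) := by
    rw [Finset.mul_sum]
    refine Finset.sum_congr rfl fun i hi => ?_
    have hi := Finset.mem_range.1 hi
    rw [hr i (by omega), hr (i + 1) (by omega)]
    ring
  have h0 := hr 0 (by omega)
  have hp := hr p (by omega)
  rw [Nat.sub_zero] at h0
  rw [show 2 * p + 2 - p = p + 2 by omega] at hp
  rw [pathA_form, h1, h2, hm, h0, hp, hl 0 (by omega), hl p (by omega)]
  ring

lemma isGreatest_spectrum_C1mat {p : ℕ} {w : ℝ} {μ : Fin (2 * p + 3) → ℝ}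
    (hμ : IsEigList (2 * p + 3) w μ) : IsGreatest (spectrum ℝ (C1mat (p + 2) w)) (μ 0) := by
  obtain ⟨⟨v, hv0, hv⟩, hmax⟩ :=
    (isHermitian_pathA (2 * p + 3) w).rayleigh_max (m := 2 * p + 1) hμ.1 hμ.2
  obtain ⟨t, ht, ⟨x, hx0, hx⟩, htmax⟩ := (isHermitian_C1mat (p + 2) w).exists_isGreatest_spectrum
  suffices μ 0 = t by rwa [this]
  have hvpos := dotProduct_self_pos_of_ne_zero hv0
  have hxpos := dotProduct_self_pos_of_ne_zero hx0
  apply le_antisymm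
  · obtain ⟨f, rfl⟩ := exists_nat_extension v
    obtain ⟨y, hyN, hyQ⟩ := exists_fold p w f
    have h := htmax (fun i => y i)
    rw [dotProduct_self_eq_sum_range] at h hv hvpos
    rw [hyN] at h
    exact le_of_mul_le_mul_right (hv.symm.le.trans (hyQ.trans h)) hvpos
  · obtain ⟨f, rfl⟩ := exists_nat_extension x
    have h := hmax (fun i => twoSidedLift p f 1 1 (√2 * f (p + 1)) i)
    rw [dotProduct_self_eq_sum_range] at h hx hxpos
    rw [twoSidedLift_sum_sq, twoSidedLift_form, mul_pow, Real.sq_sqrt (by norm_num)] at h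
    rw [C1mat_form] at hx
    rw [Finset.sum_range_succ] at hx hxpos
    refine le_of_mul_le_mul_right ?_ hxpos
    linarith

lemma isGreatest_spectrum_C2mat {p : ℕ} {w : ℝ} {μ : Fin (2 * p + 3) → ℝ}
    (hμ : IsEigList (2 * p + 3) w μ) : IsGreatest (spectrum ℝ (C2mat (p + 1) w)) (μ 1) := by
  have hA := isHermitian_pathA (2 * p + 3) w
  obtain ⟨θ, hθ, ⟨x, hx0, hx⟩, hmax⟩ := (isHermitian_C2mat (p + 1) w).exists_isGreatest_spectrum
  suffices μ 1 = θ by rwa [this]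
  apply le_antisymm
  · obtain ⟨v, hv0, hvm, hv⟩ := hA.exists_second_eigenvalue_le (m := 2 * p + 1) hμ.1 hμ.2
      (LinearMap.proj ⟨p + 1, by omega⟩)
    have hvpos := dotProduct_self_pos_of_ne_zero hv0
    obtain ⟨f, rfl⟩ := exists_nat_extension v
    replace hvm : f (p + 1) = 0 := hvm
    have h1 := hmax (fun i => f i)
    have h2 := hmax (fun i => (fun j => f (2 * p + 2 - j)) i)
    rw [C2mat_form, dotProduct_self_eq_sum_range] at h1
    rw [C2mat_form p w (fun j => f (2 * p + 2 - j)),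
      dotProduct_self_eq_sum_range (p + 1) (fun j => f (2 * p + 2 - j))] at h2
    rw [Nat.sub_zero] at h2
    rw [dotProduct_self_eq_sum_range] at hv hvpos
    rw [pathA_form] at hv
    refine le_of_mul_le_mul_right (hv.trans ?_) hvpos
    rw [pathA_sum_sq, hvm]
    linarith
  · have hxpos := dotProduct_self_pos_of_ne_zero hx0
    obtain ⟨f, rfl⟩ := exists_nat_extension x
    obtain ⟨s, t, hst, h⟩ := hA.exists_le_second_eigenvalue (m := 2 * p + 1) hμ.1 hμ.2
      (fun i => twoSidedLift p f 1 0 0 i) (fun i => twoSidedLift p f 0 1 0 i)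
    have hcomb : (s • (fun i : Fin (2 * p + 3) => twoSidedLift p f 1 0 0 i) +
        t • fun i : Fin (2 * p + 3) => twoSidedLift p f 0 1 0 i) =
        fun i : Fin (2 * p + 3) => twoSidedLift p f s t 0 i := by
      funext i
      simp only [Pi.add_apply, Pi.smul_apply, smul_eq_mul, twoSidedLift]
      split_ifs <;> ring
    have hst' : 0 < s ^ 2 + t ^ 2 := by
      rcases not_and_or.1 hst with h | h <;> positivity
    rw [hcomb, dotProduct_self_eq_sum_range, twoSidedLift_sum_sq, twoSidedLift_form] at h
    rw [dotProduct_self_eq_sum_range] at hx hxpos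
    rw [C2mat_form] at hx
    rw [hx] at h
    refine le_of_mul_le_mul_right ?_ (mul_pos hst' hxpos)
    linarith

/-- For odd `n ≥ 3` and `w > 1`, the largest eigenvalue of `A(w)` is the largest
eigenvalue of `C₁(w)` (of order `(n+1)/2`), and the second-largest eigenvalue of
`A(w)` is the largest eigenvalue of `C₂(w)` (of order `(n−1)/2`). -/
theorem lambda12_eq_C1C2_top (n : ℕ) (hn : 3 ≤ n) (hno : Odd n) (w : ℝ) (hw : 1 < w)
    (μ : Fin n → ℝ) (hμ : IsEigList n w μ) :
    IsGreatest (spectrum ℝ (C1mat ((n + 1) / 2) w)) (μ ⟨0, by omega⟩) ∧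
    IsGreatest (spectrum ℝ (C2mat ((n - 1) / 2) w)) (μ ⟨1, by omega⟩) := by
  obtain ⟨k, rfl⟩ := hno
  obtain ⟨p, rfl⟩ : ∃ p, k = p + 1 := ⟨k - 1, by omega⟩
  rw [show (2 * (p + 1) + 1 + 1) / 2 = p + 2 by omega,
    show (2 * (p + 1) + 1 - 1) / 2 = p + 1 by omega]
  exact ⟨isGreatest_spectrum_C1mat hμ, isGreatest_spectrum_C2mat hμ⟩
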